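/- In the discounted-limits setting, assume u is uniformly δ-bounded and uniformly δ-dominated, δ_n(t) ≤ t for all t ≥ 0, and for every fixed α ≥ 0, δ_n(t+α) − δ_n(t) → α as n → ∞ uniformly in t > 0. Then there exist a value ū ∈ [0, ‖u‖_∞] and a bounded continuous function h : X → ℝ such that h(x) = max_{a ∈ Ψ(x)} [u(x,a) − ū + h(f(x,a))] for all x ∈ X. -/

import Mathlib

open Filter Topology

/-- The state trajectory generated from `x` by the action sequence `a`:
`x₀ = x`, `x_{n+1} = f(x_n, a_n)`. -/
def traj {X A : Type*} (f : X × A → X) (x : X) (a : ℕ → A) : ℕ → X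
  | 0 => x
  | n + 1 => f (traj f x a n, a n)

/-- The partial star-sum `∑*_{i∈[n]} c_i = c₀ + γ(c₁ + γ(c₂ + ⋯ + γ(c_n)⋯))`. -/
noncomputable def starSum (γ : ℝ → ℝ) : (ℕ → ℝ) → ℕ → ℝ
  | c, 0 => c 0
  | c, n + 1 => c 0 + γ (starSum γ (fun i => c (i + 1)) n)

theorem cs_traj_shift {X A : Type*} (f : X × A → X) (x : X) (a : ℕ → A) (i : ℕ) :
    traj f x a (i + 1) = traj f (f (x, a 0)) (fun j => a (j + 1)) i := by
  induction i with
  | zero => rfl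
  | succ k ih =>
    show f (traj f x a (k + 1), a (k + 1)) = f (traj f (f (x, a 0)) (fun j => a (j + 1)) k, a (k + 1))
    rw [ih]

theorem cs_starSum_nonneg (γ : ℝ → ℝ) (hγ : ∀ t, 0 ≤ t → 0 ≤ γ t) (m : ℕ) :
    ∀ c : ℕ → ℝ, (∀ i, 0 ≤ c i) → 0 ≤ starSum γ c m := by
  induction m with
  | zero => intro c hc; exact hc 0
  | succ k ih =>
    intro c hc
    exact add_nonneg (hc 0) (hγ _ (ih _ (fun i => hc (i + 1))))

theorem cs_le_self (γ : ℝ → ℝ) (hmono : MonotoneOn γ (Set.Ici 0))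
    (hiter : ∀ t, 0 ≤ t → Tendsto (fun m => γ^[m] t) atTop (𝓝 0)) (t : ℝ) (ht : 0 < t) :
    γ t ≤ t := by
  by_contra hlt
  push Not at hlt
  have key : ∀ m, t ≤ γ^[m] t := by
    intro m
    induction m with
    | zero => simp
    | succ k ih =>
      rw [Function.iterate_succ_apply']
      have := hmono (show t ∈ Set.Ici 0 from ht.le) (show γ^[k] t ∈ Set.Ici 0 from ht.le.trans ih) ih
      linarith
  have := ge_of_tendsto' (hiter t ht.le) key
  linarith

/-- value iteration -/
noncomputable def csV {X A : Type*} (K : Set A) (f : X × A → X) (u : X × A → ℝ) (δ : ℝ → ℝ) :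
    ℕ → X → ℝ
  | 0 => fun _ => 0
  | n + 1 => fun x => sSup ((fun a => u (x, a) + δ (csV K f u δ n (f (x, a)))) '' K)

theorem cs_step {X A : Type*} (K : Set A) (hK : K.Nonempty) (f : X × A → X) (u : X × A → ℝ)
    (δ γ γ' : ℝ → ℝ) (D : ℝ) (hD : 0 ≤ D)
    (hunn : ∀ p, 0 ≤ u p) (hub : ∀ p, u p ≤ D)
    (hδmono : MonotoneOn δ (Set.Ici 0))
    (hδnn : ∀ t, 0 ≤ t → 0 ≤ δ t)
    (hδle : ∀ t, 0 ≤ t → δ t ≤ t)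
    (hγmono : MonotoneOn γ (Set.Ici 0)) (hγnn : ∀ t, 0 ≤ t → 0 ≤ γ t)
    (hγiter : ∀ t, 0 ≤ t → Tendsto (fun m => γ^[m] t) atTop (𝓝 0))
    (hγδ : ∀ s t, 0 ≤ s → 0 ≤ t → |δ s - δ t| ≤ γ |s - t|)
    (hγ'mono : MonotoneOn γ' (Set.Ici 0))
    (hγ'iter : ∀ t, 0 ≤ t → Tendsto (fun m => γ'^[m] t) atTop (𝓝 0))
    (hγ'γ : ∀ s t, 0 ≤ s → 0 ≤ t → |γ s - γ t| ≤ γ' |s - t|)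
    (η : ℝ) (hη : 0 < η) :
    ∃ v : X → ℝ, (∀ x, 0 ≤ v x) ∧
      (∀ x, ∀ a ∈ K, u (x, a) + δ (v (f (x, a))) ≤ v x + η) ∧
      (∀ x, ∃ a ∈ K, v x ≤ u (x, a) + δ (v (f (x, a))) + η) ∧
      ∃ m, ∀ x y, ∀ ε > 0, ∃ a : ℕ → A, (∀ i, a i ∈ K) ∧ v x - v y ≤
        starSum γ (fun i => |u (traj f x a i, a i) - u (traj f y a i, a i)|) m + ε := by
  set V := csV K f u δ with hV
  have hVS : ∀ n x, V (n + 1) x = sSup ((fun a => u (x, a) + δ (V n (f (x, a)))) '' K) :=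
    fun n x => rfl
  have hb : ∀ n x, 0 ≤ V n x ∧ V n x ≤ n * D := by
    intro n
    induction n with
    | zero => intro x; simp [hV, csV]
    | succ k ih =>
      intro x
      rw [hVS]
      constructor
      · apply Real.sSup_nonneg
        rintro _ ⟨a, ha, rfl⟩
        exact add_nonneg (hunn _) (hδnn _ (ih _).1)
      · apply csSup_le (hK.image _)
        rintro _ ⟨a, ha, rfl⟩
        have h1 := hub (x, a)
        have h2 := hδle _ (ih (f (x, a))).1
        have h3 := (ih (f (x, a))).2
        push_cast
        show u (x, a) + δ (V k (f (x, a))) ≤ _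
        linarith
  have hlow : ∀ n x, ∀ a ∈ K, u (x, a) + δ (V n (f (x, a))) ≤ V (n + 1) x := by
    intro n x a ha
    rw [hVS]
    refine le_csSup ⟨D + n * D, ?_⟩ ⟨a, ha, rfl⟩
    rintro _ ⟨b, hb', rfl⟩
    have h1 := hub (x, b)
    have h2 := hδle _ (hb n (f (x, b))).1
    have h3 := (hb n (f (x, b))).2
    show u (x, b) + δ (V n (f (x, b))) ≤ _
    linarith
  have hup : ∀ n x, ∀ ε > 0, ∃ a ∈ K, V (n + 1) x ≤ u (x, a) + δ (V n (f (x, a))) + ε := by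
    intro n x ε hε
    obtain ⟨_, ⟨a, ha, rfl⟩, hlt⟩ := exists_lt_of_lt_csSup
      (hK.image (fun a => u (x, a) + δ (V n (f (x, a)))))
      (show V (n + 1) x - ε < _ by rw [hVS]; linarith)
    refine ⟨a, ha, ?_⟩
    change V (n + 1) x - ε < u (x, a) + δ (V n (f (x, a))) at hlt
    linarith
  have hmono : ∀ n x, V n x ≤ V (n + 1) x := by
    intro n
    induction n with
    | zero => intro x; have := (hb 1 x).1; simpa [hV, csV] using this
    | succ k ih =>
      intro x
      rw [hVS k x]
      apply csSup_le (hK.image _)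
      rintro _ ⟨a, ha, rfl⟩
      refine le_trans ?_ (hlow (k + 1) x a ha)
      have := hδmono (show V k (f (x, a)) ∈ Set.Ici 0 from (hb _ _).1)
        (show V (k + 1) (f (x, a)) ∈ Set.Ici 0 from (hb _ _).1) (ih _)
      show u (x, a) + δ (V k (f (x, a))) ≤ _
      linarith
  have hdiff : ∀ n x, V (n + 1) x - V n x ≤ γ^[n] D := by
    intro n
    induction n with
    | zero =>
      intro x
      have h0 : V 0 x = 0 := rfl
      have := (hb 1 x).2
      simp at this ⊢
      linarith
    | succ k ih =>
      intro x
      rw [Function.iterate_succ_apply']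
      rw [sub_le_iff_le_add, hVS (k + 1) x]
      apply csSup_le (hK.image _)
      rintro _ ⟨a, ha, rfl⟩
      have h1 := hlow k x a ha
      have h2 := hγδ _ _ (hb (k + 1) (f (x, a))).1 (hb k (f (x, a))).1
      have h3 := sub_nonneg.2 (hmono k (f (x, a)))
      rw [abs_of_nonneg h3] at h2
      have h4 := hγmono (show _ ∈ Set.Ici (0 : ℝ) from h3)
        (show γ^[k] D ∈ Set.Ici 0 from h3.trans (ih (f (x, a)))) (ih (f (x, a)))
      have h5 := le_abs_self (δ (V (k + 1) (f (x, a))) - δ (V k (f (x, a))))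
      show u (x, a) + δ (V (k + 1) (f (x, a))) ≤ _
      linarith
  have hstar : ∀ m x y, ∀ ε > 0, ∃ a : ℕ → A, (∀ i, a i ∈ K) ∧ V (m + 1) x - V (m + 1) y ≤
        starSum γ (fun i => |u (traj f x a i, a i) - u (traj f y a i, a i)|) m + ε := by
    intro m
    induction m with
    | zero =>
      intro x y ε hε
      obtain ⟨a, ha, h1⟩ := hup 0 x ε hε
      have h2 := hlow 0 y a ha
      refine ⟨fun _ => a, fun _ => ha, ?_⟩
      have e1 : V 0 (f (x, a)) = 0 := rfl
      have e2 : V 0 (f (y, a)) = 0 := rfl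
      rw [e1] at h1
      rw [e2] at h2
      have h3 := le_abs_self (u (x, a) - u (y, a))
      show _ ≤ |u (x, a) - u (y, a)| + ε
      simp only [zero_add] at h1 h2 ⊢
      linarith
    | succ k ih =>
      intro x y ε hε
      obtain ⟨a, ha, h1⟩ := hup (k + 1) x (ε / 2) (by linarith)
      have h2 := hlow (k + 1) y a ha
      obtain ⟨b, hbK, h3⟩ := ih (f (x, a)) (f (y, a)) (ε / 2) (by linarith)
      refine ⟨fun i => Nat.casesOn i a b, ?_, ?_⟩
      · intro i
        cases i with
        | zero => exact ha
        | succ j => exact hbK j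
      · set S := starSum γ (fun i => |u (traj f (f (x, a)) b i, b i)
            - u (traj f (f (y, a)) b i, b i)|) k with hS
        have hS0 : 0 ≤ S := cs_starSum_nonneg γ hγnn k _ (fun i => abs_nonneg _)
        have h4 := le_abs_self (u (x, a) - u (y, a))
        have hγS : γ (S + ε / 2) ≤ γ S + ε / 2 := by
          have q1 := hγ'γ (S + ε / 2) S (by linarith) hS0
          have q2 := cs_le_self γ' hγ'mono hγ'iter (ε / 2) (by linarith)
          have q3 : |S + ε / 2 - S| = ε / 2 := by
            rw [add_sub_cancel_left, abs_of_pos (by linarith)]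
          rw [q3] at q1
          have := le_abs_self (γ (S + ε / 2) - γ S)
          linarith
        have h5 : δ (V (k + 1) (f (x, a))) - δ (V (k + 1) (f (y, a))) ≤ γ (S + ε / 2) := by
          rcases le_total (V (k + 1) (f (x, a))) (V (k + 1) (f (y, a))) with hle | hle
          · have := hδmono (show V (k + 1) (f (x, a)) ∈ Set.Ici 0 from (hb _ _).1)
              (show V (k + 1) (f (y, a)) ∈ Set.Ici 0 from (hb _ _).1) hle
            have := hγnn (S + ε / 2) (by linarith)
            linarith
          · have q := hγδ _ _ (hb (k + 1) (f (x, a))).1 (hb (k + 1) (f (y, a))).1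
            have q0 := sub_nonneg.2 hle
            rw [abs_of_nonneg q0] at q
            have q1 := hγmono (show _ ∈ Set.Ici (0 : ℝ) from q0)
              (show S + ε / 2 ∈ Set.Ici (0 : ℝ) from q0.trans h3) h3
            exact (le_abs_self _).trans (q.trans q1)
        have h6 : starSum γ (fun i => |u (traj f x (fun i => Nat.casesOn i a b) i,
            (fun i => Nat.casesOn i a b : ℕ → A) i)
            - u (traj f y (fun i => Nat.casesOn i a b) i,
            (fun i => Nat.casesOn i a b : ℕ → A) i)|) (k + 1) = |u (x, a) - u (y, a)| + γ S := by
          rw [hS]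
          simp only [starSum, cs_traj_shift]
          rfl
        rw [h6]
        linarith
  obtain ⟨k, hk⟩ := ((hγiter D hD).eventually (gt_mem_nhds hη)).and
    (eventually_ge_atTop 1) |>.exists
  obtain ⟨m, rfl⟩ : ∃ m, k = m + 1 := ⟨k - 1, by omega⟩
  refine ⟨V (m + 1), fun x => (hb _ x).1, ?_, ?_, m, hstar m⟩
  · intro x a ha
    have h1 := hlow (m + 1) x a ha
    have h2 := hdiff (m + 1) x
    linarith [hk.1]
  · intro x
    obtain ⟨a, ha, h⟩ := hup (m + 1) x η hη
    exact ⟨a, ha, (hmono _ x).trans h⟩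

theorem cs_ultra (F : Ultrafilter ℕ) (s : ℕ → ℝ) (a b : ℝ)
    (h : ∀ᶠ n in (F : Filter ℕ), s n ∈ Set.Icc a b) :
    ∃ l, Tendsto s (F : Filter ℕ) (𝓝 l) := by
  obtain ⟨l, -, hl⟩ := (isCompact_Icc (a := a) (b := b)).ultrafilter_le_nhds' (F.map s) h
  exact ⟨l, hl⟩

theorem cs_asymp (δ : ℕ → ℝ → ℝ)
    (hδmono : ∀ n, MonotoneOn (δ n) (Set.Ici 0))
    (hne : ∀ n s t, 0 ≤ s → 0 ≤ t → |δ n s - δ n t| ≤ |s - t|)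
    (hasymp : ∀ α : ℝ, 0 ≤ α → ∀ ε > (0 : ℝ), ∃ N : ℕ, ∀ n ≥ N, ∀ t : ℝ, 0 < t →
      |δ n (t + α) - δ n t - α| ≤ ε) (C : ℝ) (hC : 0 ≤ C) (ε : ℝ) (hε : 0 < ε) :
    ∃ N : ℕ, ∀ n ≥ N, ∀ s t : ℝ, 0 ≤ s → 0 ≤ t → |s - t| ≤ C →
      |(δ n s - δ n t) - (s - t)| ≤ ε := by
  obtain ⟨N, hN⟩ := hasymp C hC (ε / 2) (by linarith)
  refine ⟨N, fun n hn => ?_⟩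
  have key : ∀ s t : ℝ, 0 ≤ t → t ≤ s → s - t ≤ C → |(δ n s - δ n t) - (s - t)| ≤ ε := by
    intro s t ht hts hst
    have h1 := (abs_le.1 (hN n hn (t + ε / 2) (by linarith))).1
    have h2 := hne n (t + ε / 2 + C) s (by linarith) (by linarith)
    rw [abs_of_nonneg (show 0 ≤ t + ε / 2 + C - s by linarith)] at h2
    have h3 := hδmono n (show t ∈ Set.Ici 0 from ht)
      (show t + ε / 2 ∈ Set.Ici (0 : ℝ) from by show (0 : ℝ) ≤ _; linarith) (by linarith)
    have h4 := hne n s t (by linarith) ht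
    rw [abs_of_nonneg (show 0 ≤ s - t by linarith)] at h4
    rw [abs_le]
    constructor
    · linarith [le_abs_self (δ n (t + ε / 2 + C) - δ n s)]
    · linarith [le_abs_self (δ n s - δ n t)]
  intro s t hs ht hst
  rcases le_total t s with h | h
  · exact key s t ht h ((le_abs_self _).trans hst)
  · have := key t s hs h (by linarith [neg_abs_le (s - t)])
    rw [← abs_neg]
    convert this using 2
    ring

/-- In the discounted-limits setting, assume `u` is uniformly `δ`-bounded
and uniformly `δ`-dominated, `δ_n(t) ≤ t` for all `t ≥ 0`, and for every fixed `α ≥ 0`,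
`δ_n(t+α) − δ_n(t) → α` uniformly in `t > 0`.  Then there exist a value `ū ∈ [0, ‖u‖_∞]` and
a bounded continuous `h : X → ℝ` such that
`h(x) = max_{a ∈ Ψ(x)} [u(x,a) − ū + h(f(x,a))]` for all `x`. -/
theorem existence_of_calibrated_subaction
    {X A : Type*} [MetricSpace X] [CompleteSpace X] [MetricSpace A]
    (Ψ : X → Set A) (f : X × A → X) (u : X × A → ℝ) (δ γ : ℕ → ℝ → ℝ)
    (hΨc : ∀ x, IsCompact (Ψ x)) (hΨne : ∀ x, (Ψ x).Nonempty)
    (hΨconst : ∀ x y, Ψ x = Ψ y)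
    (hf : Continuous f) (hu : Continuous u)
    (hunn : ∀ p, 0 ≤ u p) (hub : ∃ D, ∀ p, u p ≤ D)
    -- each `δ n` is a variable discount function with `δ n 0 = 0`, `δ n t ≤ t`,
    -- and modulus of contraction `γ n`:
    (hδcont : ∀ n, ContinuousOn (δ n) (Set.Ici 0)) (hδmono : ∀ n, MonotoneOn (δ n) (Set.Ici 0))
    (hδnn : ∀ n t, 0 ≤ t → 0 ≤ δ n t) (hδ0 : ∀ n, δ n 0 = 0)
    (hδle : ∀ n t, 0 ≤ t → δ n t ≤ t)
    (hγmono : ∀ n, MonotoneOn (γ n) (Set.Ici 0)) (hγnn : ∀ n t, 0 ≤ t → 0 ≤ γ n t)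
    (hγiter : ∀ n t, 0 ≤ t → Tendsto (fun m => (γ n)^[m] t) atTop (𝓝 0))
    (hγδ : ∀ n s t, 0 ≤ s → 0 ≤ t → |δ n s - δ n t| ≤ γ n |s - t|)
    -- each `γ n` is itself a variable discount function, with some modulus `γ' n`:
    (hγcont : ∀ n, ContinuousOn (γ n) (Set.Ici 0)) (hγ0 : ∀ n, γ n 0 = 0)
    (hγ' : ∀ n, ∃ γ' : ℝ → ℝ, MonotoneOn γ' (Set.Ici 0) ∧ (∀ t, 0 ≤ t → 0 ≤ γ' t) ∧
      (∀ t, 0 ≤ t → Tendsto (fun m => γ'^[m] t) atTop (𝓝 0)) ∧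
      (∀ s t, 0 ≤ s → 0 ≤ t → |γ n s - γ n t| ≤ γ' |s - t|))
    -- `u` is uniformly `δ`-bounded:
    (hbdd : ∃ C : ℝ, ∀ (n : ℕ) (x y : X) (a : ℕ → A), (∀ i, a i ∈ Ψ (traj f x a i)) → ∀ m,
      starSum (γ n) (fun i => |u (traj f x a i, a i) - u (traj f y a i, a i)|) m ≤ C)
    -- `u` is uniformly `δ`-dominated:
    (hdom : ∀ ε > (0 : ℝ), ∃ θ > (0 : ℝ), ∀ (n : ℕ) (x y : X) (a : ℕ → A), dist x y ≤ θ →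
      (∀ i, a i ∈ Ψ (traj f x a i)) → ∀ m,
      starSum (γ n) (fun i => |u (traj f x a i, a i) - u (traj f y a i, a i)|) m ≤ ε)
    -- for every fixed `α ≥ 0`, `δ_n(t+α) − δ_n(t) → α` uniformly in `t > 0`:
    (hasymp : ∀ α : ℝ, 0 ≤ α → ∀ ε > (0 : ℝ), ∃ N : ℕ, ∀ n ≥ N, ∀ t : ℝ, 0 < t →
      |δ n (t + α) - δ n t - α| ≤ ε) :
    ∃ (ubar : ℝ) (h : X → ℝ), 0 ≤ ubar ∧ ubar ≤ (⨆ p, |u p|) ∧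
      Continuous h ∧ (∃ C, ∀ x, |h x| ≤ C) ∧
      ∀ x, h x = sSup ((fun a => u (x, a) - ubar + h (f (x, a))) '' Ψ x) := by
  classical
  rcases isEmpty_or_nonempty X with hX | ⟨⟨x0⟩⟩
  · refine ⟨0, fun _ => 0, le_refl _, ?_, continuous_const, ⟨0, fun x => by simp⟩,
      fun x => hX.elim x⟩
    exact Real.iSup_nonneg fun p => abs_nonneg _
  obtain ⟨D, hD⟩ := hub
  obtain ⟨C0, hC0⟩ := hbdd
  obtain ⟨a0, ha0⟩ := hΨne x0
  have hD0 : 0 ≤ D := (hunn (x0, a0)).trans (hD _)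
  set K := Ψ x0 with hKdef
  have hK : ∀ x, Ψ x = K := fun x => hΨconst x x0
  have hKc : IsCompact K := hΨc x0
  have hKn : K.Nonempty := ⟨a0, ha0⟩
  choose γ' hγ'mono hγ'nn hγ'iter hγ'γ using hγ'
  have hstep := fun n : ℕ => cs_step K hKn f u (δ n) (γ n) (γ' n) D hD0 hunn hD (hδmono n)
    (hδnn n) (hδle n) (hγmono n) (hγnn n) (hγiter n) (hγδ n) (hγ'mono n) (hγ'iter n) (hγ'γ n)
    (1 / ((n : ℝ) + 1)) (by positivity)
  choose v hv0 hvlow hvup M hvstar using hstep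
  -- bounded oscillation and equicontinuity
  have hosc : ∀ n x y, |v n x - v n y| ≤ C0 := by
    have : ∀ n x y, v n x - v n y ≤ C0 := by
      intro n x y
      refine le_of_forall_pos_le_add fun ε hε => ?_
      obtain ⟨a, ha, h⟩ := hvstar n x y ε hε
      have := hC0 n x y a (fun i => by rw [hK]; exact ha i) (M n)
      linarith
    intro n x y
    rw [abs_le]
    constructor <;> linarith [this n x y, this n y x]
  have hequi : ∀ ε > (0 : ℝ), ∃ θ > (0 : ℝ), ∀ n x y, dist x y ≤ θ → |v n x - v n y| ≤ ε := by
    intro ε hε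
    obtain ⟨θ, hθ, H⟩ := hdom ε hε
    refine ⟨θ, hθ, ?_⟩
    have : ∀ n x y, dist x y ≤ θ → v n x - v n y ≤ ε := by
      intro n x y hxy
      refine le_of_forall_pos_le_add fun ε' hε' => ?_
      obtain ⟨a, ha, h⟩ := hvstar n x y ε' hε'
      have := H n x y a hxy (fun i => by rw [hK]; exact ha i) (M n)
      linarith
    intro n x y hxy
    rw [abs_le]
    constructor <;> linarith [this n x y hxy, this n y x (by rwa [dist_comm])]
  have hC0' : 0 ≤ C0 := (abs_nonneg _).trans (hosc 0 x0 x0)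
  have hne : ∀ n s t, 0 ≤ s → 0 ≤ t → |δ n s - δ n t| ≤ |s - t| := by
    intro n s t hs ht
    rcases eq_or_ne s t with rfl | hst
    · simp
    · exact (hγδ n s t hs ht).trans
        (cs_le_self (γ n) (hγmono n) (hγiter n) _ (abs_pos.2 (sub_ne_zero.2 hst)))
  have has := cs_asymp δ hδmono hne hasymp C0 hC0'
  set F : Ultrafilter ℕ := hyperfilter ℕ with hF
  have hFle : (F : Filter ℕ) ≤ atTop := by
    rw [← Nat.cofinite_eq_atTop]; exact hyperfilter_le_cofinite
  have hη : Tendsto (fun n : ℕ => 1 / ((n : ℝ) + 1)) (F : Filter ℕ) (𝓝 0) :=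
    tendsto_one_div_add_atTop_nhds_zero_nat.mono_left hFle
  have hex : ∀ x, ∃ l, Tendsto (fun n => v n x - v n x0) (F : Filter ℕ) (𝓝 l) := fun x =>
    cs_ultra F _ (-C0) C0 (Eventually.of_forall fun n => abs_le.1 (hosc n x x0))
  choose h hh using hex
  obtain ⟨ubar, hubar⟩ : ∃ l, Tendsto (fun n => v n x0 - δ n (v n x0)) (F : Filter ℕ) (𝓝 l) := by
    refine cs_ultra F _ 0 (D + C0 + 1) (Eventually.of_forall fun n => ⟨?_, ?_⟩)
    · linarith [hδle n _ (hv0 n x0)]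
    · obtain ⟨a, ha, h1⟩ := hvup n x0
      have h2 := hD (x0, a)
      have h3 := (le_abs_self _).trans
        ((hne n _ _ (hv0 n (f (x0, a))) (hv0 n x0)).trans (hosc n _ _))
      have h4 : 1 / ((n : ℝ) + 1) ≤ 1 := by
        rw [div_le_one (by positivity)]
        linarith [(Nat.cast_nonneg n : (0 : ℝ) ≤ n)]
      linarith
  have herr : ∀ z, Tendsto (fun n => (δ n (v n z) - δ n (v n x0)) - (v n z - v n x0))
      (F : Filter ℕ) (𝓝 0) := by
    intro z
    refine Tendsto.mono_left ?_ hFle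
    rw [Metric.tendsto_atTop]
    intro ε hε
    obtain ⟨N, hN⟩ := has (ε / 2) (by linarith)
    refine ⟨N, fun n hn => ?_⟩
    have := hN n hn _ _ (hv0 n z) (hv0 n x0) (hosc n _ _)
    rw [Real.dist_eq, sub_zero]
    linarith
  have hlim : ∀ z, Tendsto (fun n => δ n (v n z) - v n x0) (F : Filter ℕ) (𝓝 (h z - ubar)) := by
    intro z
    have := ((herr z).add (hh z)).sub hubar
    rw [zero_add] at this
    refine this.congr fun n => ?_
    ring
  have hge : ∀ x, ∀ a ∈ K, u (x, a) - ubar + h (f (x, a)) ≤ h x := by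
    intro x a ha
    have h1 := (hh x).add hη
    have h2 := (hlim (f (x, a))).const_add (u (x, a))
    have := le_of_tendsto_of_tendsto' h2 h1 (fun n => by linarith [hvlow n x a ha])
    linarith
  have hle : ∀ x, ∃ a ∈ K, h x ≤ u (x, a) - ubar + h (f (x, a)) := by
    intro x
    choose b hbK hb using fun n => hvup n x
    obtain ⟨a, ha, hba⟩ := hKc.ultrafilter_le_nhds' (F.map b)
      (Ultrafilter.mem_map.2 (Filter.univ_mem' hbK))
    have hba : Tendsto b (F : Filter ℕ) (𝓝 a) := hba
    refine ⟨a, ha, ?_⟩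
    have hu1 : Tendsto (fun n => u (x, b n)) (F : Filter ℕ) (𝓝 (u (x, a))) :=
      ((hu.comp (Continuous.prodMk_right x)).tendsto a).comp hba
    have hf1 : Tendsto (fun n => f (x, b n)) (F : Filter ℕ) (𝓝 (f (x, a))) :=
      ((hf.comp (Continuous.prodMk_right x)).tendsto a).comp hba
    have hd : Tendsto (fun n => |v n (f (x, b n)) - v n (f (x, a))|) (F : Filter ℕ) (𝓝 0) := by
      rw [Metric.tendsto_nhds]
      intro ε hε
      obtain ⟨θ, hθ, H⟩ := hequi (ε / 2) (by linarith)
      filter_upwards [(Metric.tendsto_nhds.1 hf1) θ hθ] with n hn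
      have := H n _ _ hn.le
      rw [Real.dist_eq, sub_zero, abs_abs]
      linarith
    have h2 := ((hu1.add (hlim (f (x, a)))).add hd).add hη
    have := le_of_tendsto_of_tendsto' (hh x) h2 (fun n => by
      have h3 := (le_abs_self _).trans (hne n _ _ (hv0 n (f (x, b n))) (hv0 n (f (x, a))))
      linarith [hb n])
    linarith
  have hhb : ∀ x, |h x| ≤ C0 := fun x =>
    le_of_tendsto' (hh x).abs (fun n => hosc n x x0)
  haveI : Nonempty X := ⟨x0⟩
  have hbb : BddBelow (Set.range h) := ⟨-C0, by
    rintro _ ⟨x, rfl⟩; exact (abs_le.1 (hhb x)).1⟩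
  have hba : BddAbove (Set.range h) := ⟨C0, by
    rintro _ ⟨x, rfl⟩; exact (abs_le.1 (hhb x)).2⟩
  have huS : ∀ p, u p ≤ ⨆ p, |u p| := fun p =>
    (le_abs_self _).trans (le_ciSup (f := fun p => |u p|) ⟨D, by
      rintro _ ⟨q, rfl⟩
      show |u q| ≤ D
      rw [abs_of_nonneg (hunn q)]; exact hD q⟩ p)
  refine ⟨ubar, h, ?_, ?_, ?_, ⟨C0, hhb⟩, ?_⟩
  · by_contra hneg
    push Not at hneg
    obtain ⟨x, hx⟩ := exists_lt_of_ciInf_lt (show (⨅ x, h x) < (⨅ x, h x) - ubar by linarith)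
    have h1 := hge x a0 ha0
    have h2 := ciInf_le hbb (f (x, a0))
    linarith [hunn (x, a0)]
  · by_contra hneg
    push Not at hneg
    obtain ⟨x, hx⟩ := exists_lt_of_lt_ciSup
      (show (⨆ x, h x) - (ubar - ⨆ p, |u p|) < (⨆ x, h x) by linarith)
    obtain ⟨a, ha, h1⟩ := hle x
    have h2 := le_ciSup hba (f (x, a))
    linarith [huS (x, a)]
  · rw [Metric.continuous_iff]
    intro y ε hε
    obtain ⟨θ, hθ, H⟩ := hequi (ε / 2) (by linarith)
    refine ⟨θ, hθ, fun x hx => ?_⟩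
    have := le_of_tendsto' ((hh x).sub (hh y)).abs (b := ε / 2) (fun n => by
      have := H n x y hx.le
      simpa using this)
    rw [Real.dist_eq]
    linarith
  · intro x
    rw [hK]
    symm
    apply IsGreatest.csSup_eq
    obtain ⟨a, ha, h1⟩ := hle x
    refine ⟨⟨a, ha, le_antisymm (hge x a ha) h1⟩, ?_⟩
    rintro _ ⟨b, hb, rfl⟩
    exact hge x b hb
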